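/- arXiv:2309.07558 — 4 statements merged into one kernel-verified Lean document; each statement's English description precedes it below -/
import Mathlib

section
/- Let ξ be a real number and let r ∈ (0,1). Then (2πi)^{-1} times the integral of the function η ↦ 1/((ξ − η)(1 + η²)²) over the positively oriented circle in ℂ centered at i with radius r equals −(2 + iξ)/(4(ξ − i)²). -/
open Complex Real

/-- A point of the upper half-plane is distinct from every real number and from `-i`. -/
lemma sub_ne_zero_and_add_I_ne_zero_of_im_pos {η : ℂ} (h : 0 < η.im) (ξ : ℝ) :
    (ξ : ℂ) - η ≠ 0 ∧ η + Complex.I ≠ 0 := by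
  constructor <;> intro h0 <;> have := congrArg Complex.im h0 <;> simp at this <;> linarith

/-- The closed disc of radius `r < 1` centered at `i` lies in the upper half-plane. -/
lemma im_pos_of_mem_closedBall_I {η : ℂ} {r : ℝ} (hr : r < 1)
    (h : η ∈ Metric.closedBall Complex.I r) : 0 < η.im := by
  have h1 := (Complex.abs_im_le_norm (η - Complex.I)).trans (mem_closedBall_iff_norm.1 h)
  simp only [Complex.sub_im, Complex.I_im] at h1
  linarith [(abs_le.1 h1).1]

/-- The derivative of `η ↦ 1 / ((ξ - η) (η + i)²)` on the upper half-plane. -/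
lemma hasDerivAt_inv_sub_mul_add_I_sq {η : ℂ} (h : 0 < η.im) (ξ : ℝ) :
    HasDerivAt (fun z : ℂ => (((ξ : ℂ) - z) * (z + Complex.I) ^ 2)⁻¹)
      (-(-(η + Complex.I) ^ 2 + ((ξ : ℂ) - η) * (2 * (η + Complex.I))) /
        (((ξ : ℂ) - η) * (η + Complex.I) ^ 2) ^ 2) η := by
  obtain ⟨h1, h2⟩ := sub_ne_zero_and_add_I_ne_zero_of_im_pos h ξ
  refine ((((hasDerivAt_id η).const_sub (ξ : ℂ)).mul
    (((hasDerivAt_id η).add_const Complex.I).pow 2)).inv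
      (mul_ne_zero h1 (pow_ne_zero 2 h2))).congr_deriv ?_
  simp

/-- Szegő-type projection evaluation: for `ξ : ℝ` and `r ∈ (0,1)`,
`(2πi)⁻¹ ∮_{C(i,r)} 1/((ξ − η)(1 + η²)²) dη = −(2 + iξ)/(4(ξ − i)²)`. -/
theorem circle_integral_pi_plus_one_div_one_add_sq_sq
    (ξ : ℝ) (r : ℝ) (hr : r ∈ Set.Ioo (0 : ℝ) 1) :
    (2 * (Real.pi : ℂ) * Complex.I)⁻¹ *
      (∮ η in C(Complex.I, r), 1 / (((ξ : ℂ) - η) * (1 + η ^ 2) ^ 2))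
      = -(2 + Complex.I * (ξ : ℂ)) / (4 * ((ξ : ℂ) - Complex.I) ^ 2) := by
  have hU : IsOpen {z : ℂ | 0 < z.im} := isOpen_lt continuous_const Complex.continuous_im
  have hI : 0 < Complex.I.im := by simp
  have cauchy := two_pi_I_inv_smul_circleIntegral_sub_sq_inv_smul_of_differentiable hU
    (fun η hη => im_pos_of_mem_closedBall_I hr.2 hη)
    (fun η hη => (hasDerivAt_inv_sub_mul_add_I_sq hη ξ).differentiableAt.differentiableWithinAt)
    (Metric.mem_ball_self hr.1)
  have integrand (η : ℂ) : 1 / (((ξ : ℂ) - η) * (1 + η ^ 2) ^ 2) =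
      ((η - Complex.I) ^ 2)⁻¹ • (((ξ : ℂ) - η) * (η + Complex.I) ^ 2)⁻¹ := by
    rw [smul_eq_mul, ← mul_inv, one_div]
    congr 1
    linear_combination (ξ - η) * (2 * η ^ 2 + 1 - Complex.I ^ 2) * Complex.I_sq
  simp only [integrand]
  rw [← smul_eq_mul, cauchy, (hasDerivAt_inv_sub_mul_add_I_sq hI ξ).deriv]
  have h1 := (sub_ne_zero_and_add_I_ne_zero_of_im_pos hI ξ).1
  have h2 : (Complex.I + Complex.I) ^ 2 = -4 := by linear_combination 4 * Complex.I_sq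
  rw [h2, div_eq_div_iff (by simp [h1]) (by simp [h1])]
  linear_combination 16 * ((ξ : ℂ) - Complex.I) ^ 2 * Complex.I_sq
end

section
/- Let r ∈ (0,2). The integral of the function z ↦ z/((z − i)³(z + i)²) over the positively oriented circle in ℂ centered at i with radius r equals π/8. -/
open Complex Real

theorem hasDerivAt_div_add_I_sq {z : ℂ} (hz : z + I ≠ 0) :
    HasDerivAt (fun w : ℂ => w / (w + I) ^ 2) ((I - z) / (z + I) ^ 3) z := by
  have h := (hasDerivAt_id' z).div (((hasDerivAt_id' z).add_const I).pow 2) (pow_ne_zero 2 hz)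
  refine h.congr_deriv ?_
  simp only [Pi.pow_apply]
  field_simp
  push_cast
  ring

theorem iteratedDeriv_two_div_add_I_sq :
    iteratedDeriv 2 (fun w : ℂ => w / (w + I) ^ 2) I = -I / 8 := by
  have hI : I + I ≠ 0 := by simp [← two_mul]
  have hderiv : deriv (fun w : ℂ => w / (w + I) ^ 2) =ᶠ[nhds I]
      fun w => (I - w) / (w + I) ^ 3 := by
    have hcont : ContinuousAt (fun w : ℂ => w + I) I := by fun_prop
    filter_upwards [hcont.eventually_ne hI] with w hw
    exact (hasDerivAt_div_add_I_sq hw).deriv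
  rw [iteratedDeriv_succ, iteratedDeriv_one, hderiv.deriv_eq]
  have h := ((hasDerivAt_id' I).const_sub I).div (((hasDerivAt_id' I).add_const I).pow 3)
    (pow_ne_zero 3 hI)
  refine h.deriv.trans ?_
  simp only [Pi.pow_apply, sub_self, zero_mul, sub_zero, ← two_mul]
  field_simp
  norm_num [I_sq, I_pow_four]

/-- For `r ∈ (0,2)`, `∮_{C(i,r)} z/((z − i)³(z + i)²) dz = π/8`. -/
theorem circle_integral_z_div_pole3_2 (r : ℝ) (hr : r ∈ Set.Ioo (0 : ℝ) 2) :
    (∮ z in C(Complex.I, r), z / ((z - Complex.I) ^ 3 * (z + Complex.I) ^ 2))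
      = (Real.pi : ℂ) / 8 := by
  have hd : DifferentiableOn ℂ (fun w : ℂ => w / (w + I) ^ 2) (Metric.closedBall I r) := by
    intro z hz
    refine (hasDerivAt_div_add_I_sq fun h => ?_).differentiableAt.differentiableWithinAt
    rw [eq_neg_of_add_eq_zero_left h, mem_closedBall_iff_norm, ← neg_add', norm_neg,
      ← two_mul] at hz
    norm_num at hz
    exact hz.not_gt hr.2
  have h := hd.circleIntegral_one_div_sub_center_pow_smul hr.1 2
  rw [iteratedDeriv_two_div_add_I_sq] at h
  calc _ = ∮ z in C(I, r), (1 / (z - I) ^ (2 + 1)) • (z / (z + I) ^ 2) := by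
        congr 1
        ext z
        rw [smul_eq_mul, div_mul_div_comm, one_mul]
    _ = (2 * π * I / (Nat.factorial 2 : ℕ)) • (-I / 8) := h
    _ = π / 8 := by
        norm_num [Nat.factorial]
        linear_combination (-π / 8 : ℂ) * I_sq
end

section
/- Let r ∈ (0,2). The integral of the function z ↦ (3z² − 1)/((z − i)⁵(z + i)³) over the positively oriented circle in ℂ centered at i with radius r equals 3π/16. -/
open Complex Real

/-- The partial expansion at `i` of the integrand, obtained from
`(z + i)³ - (z - i)³ = 2i(3z² - 1)`. -/
lemma three_sq_sub_one_div_eq {z : ℂ} (h₁ : z - I ≠ 0) (h₂ : z + I ≠ 0) :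
    (3 * z ^ 2 - 1) / ((z - I) ^ 5 * (z + I) ^ 3) =
      (2 * I)⁻¹ * ((z - I) ^ (-5 : ℤ) - ((z - I) ^ 2)⁻¹ • ((z + I) ^ 3)⁻¹) := by
  have h : 3 * z ^ 2 - 1 = (2 * I)⁻¹ * ((z + I) ^ 3 - (z - I) ^ 3) := by
    rw [eq_inv_mul_iff_mul_eq₀ (by simp)]
    linear_combination (-2 * I) * I_sq
  rw [h, smul_eq_mul, show (z - I) ^ (-5 : ℤ) = ((z - I) ^ 5)⁻¹ from zpow_neg _ 5]
  field_simp

/-- The factor `(z + i)⁻³` is holomorphic away from `-i`. -/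
lemma hasDerivAt_inv_add_I_pow_three {z : ℂ} (hz : z + I ≠ 0) :
    HasDerivAt (fun w : ℂ => ((w + I) ^ 3)⁻¹) (-(3 * (z + I) ^ 2) / ((z + I) ^ 3) ^ 2) z := by
  simpa using (((hasDerivAt_id z).add_const I).pow 3).fun_inv (pow_ne_zero 3 hz)

/-- For `r ∈ (0,2)`, `∮_{C(i,r)} (3z² − 1)/((z − i)⁵(z + i)³) dz = 3π/16`. -/
theorem circle_integral_three_sq_sub_one_div_pole5_3 (r : ℝ) (hr : r ∈ Set.Ioo (0 : ℝ) 2) :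
    (∮ z in C(Complex.I, r), (3 * z ^ 2 - 1) / ((z - Complex.I) ^ 5 * (z + Complex.I) ^ 3))
      = 3 * (Real.pi : ℂ) / 16 := by
  obtain ⟨hr₀, hr₂⟩ := hr
  have hadd : ∀ z ∈ Metric.closedBall I r, z + I ≠ 0 := by
    intro z hz h
    rw [eq_neg_of_add_eq_zero_left h, Metric.mem_closedBall, Complex.dist_eq,
      show -I - I = -(2 * I) by ring] at hz
    simp at hz
    linarith
  have hsub : ∀ z ∈ Metric.sphere I r, z - I ≠ 0 := fun z hz =>
    sub_ne_zero.mpr (ne_of_mem_of_not_mem hz (by simpa using hr₀.ne))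
  have hcauchy := two_pi_I_inv_smul_circleIntegral_sub_sq_inv_smul_of_differentiable
    (f := fun w : ℂ => ((w + I) ^ 3)⁻¹) (U := {z | z + I ≠ 0})
    (isOpen_ne_fun (by fun_prop) (by fun_prop)) hadd
    (fun z hz => (hasDerivAt_inv_add_I_pow_three hz).differentiableAt.differentiableWithinAt)
    (Metric.mem_ball_self hr₀)
  rw [(hasDerivAt_inv_add_I_pow_three (hadd I (Metric.mem_closedBall_self hr₀.le))).deriv,
    smul_eq_mul, inv_mul_eq_iff_eq_mul₀ two_pi_I_ne_zero] at hcauchy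
  rw [circleIntegral.integral_congr hr₀.le fun z hz =>
      three_sq_sub_one_div_eq (hsub z hz) (hadd z (Metric.sphere_subset_closedBall hz)),
    circleIntegral.integral_const_mul, circleIntegral.integral_sub, hcauchy,
    circleIntegral.integral_sub_zpow_of_ne (by norm_num)]
  · have hI : I ≠ 0 := I_ne_zero
    rw [← two_mul]
    field_simp
    rw [I_pow_four]
    ring
  · exact ContinuousOn.circleIntegrable hr₀.le fun z hz =>
      ((continuousAt_id.sub continuousAt_const).zpow₀ (-5)
        (Or.inl (hsub z hz))).continuousWithinAt
  · exact ContinuousOn.circleIntegrable hr₀.le fun z hz =>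
      (((by fun_prop : ContinuousAt (fun w : ℂ => (w - I) ^ 2) z).inv₀
        (pow_ne_zero 2 (hsub z hz))).smul (hasDerivAt_inv_add_I_pow_three
          (hadd z (Metric.sphere_subset_closedBall hz))).continuousAt).continuousWithinAt
end

section
/- Let r ∈ (0,2). The integral of the function z ↦ (3iz³ + 6z² − iz − 2)/((z − i)⁵(z + i)³) over the positively oriented circle in ℂ centered at i with radius r equals 5π/16. -/
open Complex Real

/-- The Laurent expansion at `i` of the integrand, with the regular part in closed form. -/
lemma cubic_div_pole5_3_eq_laurent {z : ℂ} (h₁ : z - Complex.I ≠ 0) (h₂ : z + Complex.I ≠ 0) :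
    (3 * Complex.I * z ^ 3 + 6 * z ^ 2 - Complex.I * z - 2) /
        ((z - Complex.I) ^ 5 * (z + Complex.I) ^ 3) =
      -(Complex.I / 2) * (z - Complex.I) ^ (-5 : ℤ) + 1 / 2 * (z - Complex.I) ^ (-4 : ℤ) +
        -(1 / 16) * (z - Complex.I) ^ (-2 : ℤ) + -(5 * Complex.I / 32) * (z - Complex.I)⁻¹ +
        Complex.I / 32 * (-48 + 28 * Complex.I * (z - Complex.I) + 5 * (z - Complex.I) ^ 2) /
          (z + Complex.I) ^ 3 := by
  have hI : Complex.I ^ 2 = -1 := Complex.I_sq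
  simp only [zpow_neg, zpow_ofNat]
  generalize Complex.I = i at *
  field_simp
  grind

/-- For `r ∈ (0,2)`,
`∮_{C(i,r)} (3iz³ + 6z² − iz − 2)/((z − i)⁵(z + i)³) dz = 5π/16`. -/
theorem circle_integral_cubic_div_pole5_3 (r : ℝ) (hr : r ∈ Set.Ioo (0 : ℝ) 2) :
    (∮ z in C(Complex.I, r),
        (3 * Complex.I * z ^ 3 + 6 * z ^ 2 - Complex.I * z - 2) /
          ((z - Complex.I) ^ 5 * (z + Complex.I) ^ 3))
      = 5 * (Real.pi : ℂ) / 16 := by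
  obtain ⟨hr0, hr2⟩ := hr
  have h_add : ∀ z ∈ Metric.closedBall Complex.I r, z + Complex.I ≠ 0 := by
    intro z hz h
    rw [eq_neg_of_add_eq_zero_left h, Metric.mem_closedBall, dist_eq_norm,
      show -Complex.I - Complex.I = -2 * Complex.I by ring] at hz
    norm_num at hz
    linarith
  have h_sub : ∀ z ∈ Metric.sphere Complex.I r, z - Complex.I ≠ 0 := fun z hz =>
    sub_ne_zero.2 (Metric.ne_of_mem_sphere hz hr0.ne')
  have h_regular : DifferentiableOn ℂ (fun z : ℂ => Complex.I / 32 *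
      (-48 + 28 * Complex.I * (z - Complex.I) + 5 * (z - Complex.I) ^ 2) / (z + Complex.I) ^ 3)
      (Metric.closedBall Complex.I r) :=
    DifferentiableOn.div (by fun_prop) (by fun_prop) fun z hz => pow_ne_zero 3 (h_add z hz)
  have h_regular_integrable :=
    (h_regular.continuousOn.mono Metric.sphere_subset_closedBall).circleIntegrable hr0.le
  have h_zpow (a : ℂ) (n : ℤ) :
      CircleIntegrable (fun z => a * (z - Complex.I) ^ n) Complex.I r :=
    ContinuousOn.circleIntegrable hr0.le <| continuousOn_const.mul <|
      (by fun_prop : ContinuousOn (fun z : ℂ => z - Complex.I) _).zpow₀ n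
        fun z hz => Or.inl (h_sub z hz)
  have h_inv (a : ℂ) : CircleIntegrable (fun z => a * (z - Complex.I)⁻¹) Complex.I r := by
    simpa only [zpow_neg_one] using h_zpow a (-1)
  rw [circleIntegral.integral_congr hr0.le fun z hz => cubic_div_pole5_3_eq_laurent (h_sub z hz)
      (h_add z (Metric.sphere_subset_closedBall hz)),
    circleIntegral.integral_add ?_ h_regular_integrable,
    circleIntegral.integral_add ?_ (h_inv _),
    circleIntegral.integral_add ?_ (h_zpow _ _),
    circleIntegral.integral_add (h_zpow _ _) (h_zpow _ _),
    (h_regular.mono Metric.closure_ball_subset_closedBall).diffContOnCl.circleIntegral_eq_zero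
      hr0.le]
  · simp only [circleIntegral.integral_const_mul, circleIntegral.integral_sub_center_inv _ hr0.ne']
    rw [circleIntegral.integral_sub_zpow_of_ne (by norm_num),
      circleIntegral.integral_sub_zpow_of_ne (by norm_num),
      circleIntegral.integral_sub_zpow_of_ne (by norm_num)]
    linear_combination -(5 * (Real.pi : ℂ) / 16) * Complex.I_sq
  · exact (h_zpow _ _).add (h_zpow _ _)
  · exact ((h_zpow _ _).add (h_zpow _ _)).add (h_zpow _ _)
  · exact (((h_zpow _ _).add (h_zpow _ _)).add (h_zpow _ _)).add (h_inv _)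
end
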